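/- arXiv:2403.04126 — 2 statements merged into one kernel-verified Lean document; each statement's English description precedes it below -/
import Mathlib

section
/- Let G = (V, E) be a finite simple graph and let X₁, …, Xₙ be a sequence of subsets of V that is a measurement schedule on G, i.e., (M1) for every vertex v ∈ V the set of indices i with v ∈ Xᵢ is a nonempty set of consecutive integers, and (M2) for every vertex v ∈ V, if k is the largest index with v ∈ X_k, then every neighbour of v belongs to X_j for some j ≤ k. Then X₁, …, Xₙ is a path decomposition of G, i.e., (P1) every vertex of G lies in some Xᵢ, (P2) for every edge {u, v} ∈ E there exists an i with {u, v} ⊆ Xᵢ, and (P3) for all i ≤ j ≤ k, if v ∈ Xᵢ ∩ X_k then v ∈ X_j. -/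
/-- Condition M1: each vertex appears in a nonempty, consecutive (interval) set of bags. -/
def CondM1 {V : Type*} {n : ℕ} (X : Fin n → Finset V) : Prop :=
  ∀ v : V, (∃ i, v ∈ X i) ∧
    ∀ i j k : Fin n, i ≤ j → j ≤ k → v ∈ X i → v ∈ X k → v ∈ X j

/-- Condition M2: if `k` is the largest index with `v ∈ X k`, then every neighbour of `v`
belongs to some bag with index at most `k`. -/
def CondM2 {V : Type*} (G : SimpleGraph V) {n : ℕ} (X : Fin n → Finset V) : Prop :=
  ∀ v : V, ∀ k : Fin n, v ∈ X k → (∀ k' : Fin n, v ∈ X k' → k' ≤ k) →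
    ∀ u : V, G.Adj u v → ∃ j : Fin n, j ≤ k ∧ u ∈ X j

/-- A measurement schedule on the graph state `|G⟩`. -/
def IsMeasurementSchedule {V : Type*} (G : SimpleGraph V) {n : ℕ} (X : Fin n → Finset V) :
    Prop :=
  CondM1 X ∧ CondM2 G X

/-- Condition P1: every vertex lies in some bag. -/
def CondP1 {V : Type*} {n : ℕ} (X : Fin n → Finset V) : Prop :=
  ∀ v : V, ∃ i, v ∈ X i

/-- Condition P2: every edge is contained in some bag. -/
def CondP2 {V : Type*} (G : SimpleGraph V) {n : ℕ} (X : Fin n → Finset V) : Prop :=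
  ∀ u v : V, G.Adj u v → ∃ i : Fin n, u ∈ X i ∧ v ∈ X i

/-- Condition P3: the bags containing a given vertex form an interval. -/
def CondP3 {V : Type*} {n : ℕ} (X : Fin n → Finset V) : Prop :=
  ∀ i j k : Fin n, i ≤ j → j ≤ k → ∀ v : V, v ∈ X i → v ∈ X k → v ∈ X j

/-- A path decomposition of the graph `G`. -/
def IsPathDecomposition {V : Type*} (G : SimpleGraph V) {n : ℕ} (X : Fin n → Finset V) :
    Prop :=
  CondP1 X ∧ CondP2 G X ∧ CondP3 X

/-- A vertex of a bag has a last bag containing it. -/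
theorem exists_last_bag {V : Type*} {n : ℕ} (X : Fin n → Finset V) {v : V}
    (hv : ∃ i, v ∈ X i) : ∃ k, v ∈ X k ∧ ∀ k', v ∈ X k' → k' ≤ k := by
  obtain ⟨k, hk, hmax⟩ := Set.exists_max_image {i | v ∈ X i} id (Set.toFinite _) hv
  exact ⟨k, hk, hmax⟩

/-- Every measurement schedule on `|G⟩` is a path decomposition of `G`. -/
theorem measurementSchedule_isPathDecomposition {V : Type*} [Fintype V]
    (G : SimpleGraph V) {n : ℕ} (X : Fin n → Finset V)
    (hX : IsMeasurementSchedule G X) : IsPathDecomposition G X := by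
  obtain ⟨h1, h2⟩ := hX
  refine ⟨fun v => (h1 v).1, fun u v huv => ?_, fun i j k hij hjk v => (h1 v).2 i j k hij hjk⟩
  obtain ⟨a, hua, ha⟩ := exists_last_bag X (h1 u).1
  obtain ⟨b, hvb, hb⟩ := exists_last_bag X (h1 v).1
  rcases le_total a b with hab | hba
  · obtain ⟨j, hja, hvj⟩ := h2 u a hua ha v huv.symm
    exact ⟨a, hua, (h1 v).2 j a b hja hab hvj hvb⟩
  · obtain ⟨j, hjb, huj⟩ := h2 v b hvb hb u huv
    exact ⟨b, (h1 u).2 j b a hjb hba huj hua, hvb⟩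
end

section
/- Let G = (V, E) be a finite simple graph and let X₁, …, Xₙ be a sequence of subsets of V. Then X₁, …, Xₙ is a measurement schedule on G if and only if X₁, …, Xₙ is a path decomposition of G. That is, the conjunction of conditions M1 and M2 holds if and only if the conjunction of conditions P1, P2 and P3 holds. -/
/-- In a sequence covering every vertex, each vertex has a largest index. -/
theorem CondP1.exists_last {V : Type*} {n : ℕ} {X : Fin n → Finset V} (h : CondP1 X) (v : V) :
    ∃ k, v ∈ X k ∧ ∀ k', v ∈ X k' → k' ≤ k := by
  classical
  obtain ⟨i, hi⟩ := h v
  obtain ⟨k, hk, hmax⟩ := (Finset.univ.filter fun k => v ∈ X k).exists_max_image id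
    ⟨i, by simpa using hi⟩
  exact ⟨k, by simpa using hk, fun k' hk' => hmax k' (by simpa using hk')⟩

/-- A sequence of subsets of `V` is a measurement schedule on `|G⟩` if and only if
it is a path decomposition of `G`. -/
theorem measurementSchedule_iff_pathDecomposition {V : Type*} [Fintype V]
    (G : SimpleGraph V) {n : ℕ} (X : Fin n → Finset V) :
    IsMeasurementSchedule G X ↔ IsPathDecomposition G X := by
  constructor
  · rintro ⟨h1, h2⟩
    have hP1 : CondP1 X := fun v => (h1 v).1
    refine ⟨hP1, fun u v huv => ?_, fun i j k hij hjk v => (h1 v).2 i j k hij hjk⟩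
    obtain ⟨a, ha, ha_max⟩ := hP1.exists_last u
    obtain ⟨b, hb, hb_max⟩ := hP1.exists_last v
    rcases le_total a b with hab | hba
    · obtain ⟨j, hj, hvj⟩ := h2 u a ha ha_max v huv.symm
      exact ⟨a, ha, (h1 v).2 j a b hj hab hvj hb⟩
    · obtain ⟨j, hj, huj⟩ := h2 v b hb hb_max u huv
      exact ⟨b, (h1 u).2 j b a hj hba huj ha, hb⟩
  · rintro ⟨h1, h2, h3⟩
    refine ⟨fun v => ⟨h1 v, fun i j k hij hjk => h3 i j k hij hjk v⟩, fun v k _ hmax u huv => ?_⟩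
    obtain ⟨i, hu, hv⟩ := h2 u v huv
    exact ⟨i, hmax i hv, hu⟩
end
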